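/- arXiv:2303.06300 — 2 statements merged into one kernel-verified Lean document; each statement's English description precedes it below -/
import Mathlib

section
/- Let ρ be the canonical sequential form of a non-crossing partition of length m ≥ 1 and let a, b ≥ 1. Then for every n and every k, the number of non-crossing partitions of [n] with exactly k occurrences of the subword 1^a(ρ+1)1^b equals the number with exactly k occurrences of 1^b(ρ+1)1^a. In particular, the patterns 1^a(ρ+1)1^b and 1^b(ρ+1)1^a are equidistributed on NC_n. -/
/-- `l` is a restricted growth sequence (canonical sequential form of a set
partition): it starts with 1, all letters are ≥ 1, and each letter is at most
one more than the maximum of the preceding prefix. -/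
def IsRGS (l : List ℕ) : Prop :=
  l.getD 0 1 = 1 ∧ (∀ x ∈ l, 1 ≤ x) ∧
  ∀ i, i + 1 < l.length → l.getD (i + 1) 0 ≤ (l.take (i + 1)).foldr max 0 + 1

/-- `l` contains a (classical) occurrence of 1-2-1-2: a subsequence a,b,a,b with a < b. -/
def Crossing (l : List ℕ) : Prop :=
  ∃ i j k m : ℕ, i < j ∧ j < k ∧ k < m ∧ m < l.length ∧
    l.getD i 0 = l.getD k 0 ∧ l.getD j 0 = l.getD m 0 ∧ l.getD i 0 < l.getD j 0

/-- `l` is the canonical sequential form of a non-crossing partition of [n]. -/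
def NCseq (n : ℕ) (l : List ℕ) : Prop := l.length = n ∧ IsRGS l ∧ ¬ Crossing l

/-- Two lists of the same length are order-isomorphic. -/
def OrdIso (s t : List ℕ) : Prop :=
  s.length = t.length ∧ ∀ j k, j < s.length → k < s.length →
    (s.getD j 0 < s.getD k 0 ↔ t.getD j 0 < t.getD k 0)

/-- The subword pattern `τ` occurs in `l` starting at position `i`. -/
def occAt (τ l : List ℕ) (i : ℕ) : Prop := OrdIso τ ((l.drop i).take τ.length)

/-- The number of occurrences of the subword pattern `τ` in `l`. -/
noncomputable def occCount (τ l : List ℕ) : ℕ := Nat.card {i : ℕ // occAt τ l i}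

/-- The total number of occurrences of the subword pattern `τ` over all
members of NC_n, counted with multiplicity (as marked occurrences). -/
noncomputable def totalOcc (n : ℕ) (τ : List ℕ) : ℕ :=
  Nat.card {p : List ℕ × ℕ // NCseq n p.1 ∧ occAt τ p.1 p.2}

/-- Plane forests in first-child / next-sibling form. The children of the (virtual) root are
listed by `Forest.toList`, each of them being the forest hanging below that child. -/
inductive Forest : Type
  | nil : Forest
  | node (l r : Forest) : Forest

namespace Forest

/-- The number of nodes. -/
def size : Forest → ℕ
  | nil => 0
  | node l r => l.size + r.size + 1

/-- The subforests hanging below the roots, from left to right. -/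
def toList : Forest → List Forest
  | nil => []
  | node l r => l :: r.toList

/-- The inverse of `Forest.toList`. -/
def ofList : List Forest → Forest
  | [] => nil
  | l :: L => node l (ofList L)

@[simp] lemma toList_ofList (L : List Forest) : (ofList L).toList = L := by
  induction L with
  | nil => rfl
  | cons c L ih => simp [ofList, toList, ih]

@[simp] lemma ofList_toList (t : Forest) : ofList t.toList = t := by
  induction t with
  | nil => rfl
  | node l r _ ihr => simp [ofList, toList, ihr]

lemma size_eq_sum (t : Forest) : t.size = (t.toList.map fun c => c.size + 1).sum := by
  induction t with
  | nil => rfl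
  | node l r _ ihr => simp [size, toList, ihr]; omega

lemma size_lt_of_mem_toList {c t : Forest} (h : c ∈ t.toList) : c.size < t.size := by
  rw [size_eq_sum t]
  exact Nat.lt_of_succ_le (List.single_le_sum (by simp) _ (List.mem_map_of_mem h))

end Forest

/-! ### Counting factors of a list -/

section Factors

variable {α β : Type*}

open scoped Classical in
/-- The number of occurrences of the nonempty word `u` as a factor of a list. -/
noncomputable def factorCount (u : List α) : List α → ℕ
  | [] => 0
  | c :: L => (if u <+: c :: L then 1 else 0) + factorCount u L

open scoped Classical in
lemma factorCount_concat {u : List α} (hu : u ≠ []) (L : List α) (c : α) :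
    factorCount u (L ++ [c]) = (if u <:+ L ++ [c] then 1 else 0) + factorCount u L := by
  induction L with
  | nil =>
    have h : u <+: [c] ↔ u <:+ [c] := by
      rw [List.prefix_cons_iff, List.suffix_cons_iff]
      simp [hu]
    simp [factorCount, h]
  | cons d L ih =>
    simp only [List.cons_append, factorCount] at ih ⊢
    rw [ih]
    by_cases h : u = d :: (L ++ [c])
    · have h1 : ¬ u <:+ L ++ [c] := fun h' => by
        have := h'.length_le
        simp [h] at this
      have h2 : ¬ u <+: d :: L := fun h' => by
        have := h'.length_le
        simp [h] at this
      have h3 : u <+: d :: (L ++ [c]) := h ▸ List.prefix_rfl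
      have h4 : u <:+ d :: (L ++ [c]) := h ▸ List.suffix_rfl
      simp only [h1, h2, h3, h4, if_true, if_false, zero_add]
    · have h1 : u <:+ d :: (L ++ [c]) ↔ u <:+ L ++ [c] := by
        rw [List.suffix_cons_iff]; simp [h]
      have h2 : u <+: d :: (L ++ [c]) ↔ u <+: d :: L := by
        rw [← List.cons_append, List.prefix_concat_iff]; simp [h]
      simp only [h1, h2]
      omega

open scoped Classical in
lemma factorCount_reverse {u : List α} (hu : u ≠ []) (L : List α) :
    factorCount u.reverse L.reverse = factorCount u L := by
  induction L with
  | nil => rfl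
  | cons c L ih =>
    have h : u.reverse <:+ L.reverse ++ [c] ↔ u <+: c :: L := by
      rw [← List.reverse_cons, List.reverse_suffix]
    rw [List.reverse_cons, factorCount_concat (by simpa using hu), ih, factorCount]
    congr 1
    exact if_congr h rfl rfl

open scoped Classical in
lemma factorCount_map {u : List α} {g : α → α} (hg : Function.Injective g) (hu : u.map g = u)
    (L : List α) : factorCount u (L.map g) = factorCount u L := by
  induction L with
  | nil => rfl
  | cons c L ih =>
    have h : u <+: (c :: L).map g ↔ u <+: c :: L := by
      conv_lhs => rw [← hu]
      exact List.prefix_map_iff_of_injective hg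
    rw [List.map_cons] at h
    rw [List.map_cons, factorCount, factorCount, ih]
    congr 1
    exact if_congr h rfl rfl

/-- Reverse a list except for its last entry, which stays in place. -/
def reverseInit (L : List α) : List α := L.dropLast.reverse ++ L.getLast?.toList

lemma dropLast_reverseInit (L : List α) : (reverseInit L).dropLast = L.dropLast.reverse := by
  rcases List.eq_nil_or_concat L with rfl | ⟨L, c, rfl⟩ <;> simp [reverseInit]

lemma reverseInit_reverseInit (L : List α) : reverseInit (reverseInit L) = L := by
  rcases List.eq_nil_or_concat L with rfl | ⟨L, c, rfl⟩ <;> simp [reverseInit]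

lemma reverseInit_map (g : α → β) (L : List α) :
    reverseInit (L.map g) = (reverseInit L).map g := by
  rcases List.eq_nil_or_concat L with rfl | ⟨L, c, rfl⟩ <;> simp [reverseInit]

lemma reverseInit_perm (L : List α) : (reverseInit L).Perm L := by
  rcases List.eq_nil_or_concat L with rfl | ⟨L, c, rfl⟩
  · simp [reverseInit]
  · simpa [reverseInit] using (List.reverse_perm L).append_right [c]

end Factors

namespace Forest

/-! ### The pattern statistic on forests and the mirror involution -/

open scoped Classical in
/-- The number of factors `u` among the non-last siblings, over all sibling lists. -/
noncomputable def count (u : List Forest) : Forest → ℕ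
  | nil => 0
  | node l r => l.count u + r.count u + if u <+: (l :: r.toList).dropLast then 1 else 0

open scoped Classical in
lemma count_eq_sum {u : List Forest} (hu : u ≠ []) (t : Forest) :
    t.count u = (t.toList.map (count u)).sum + factorCount u t.toList.dropLast := by
  induction t with
  | nil => rfl
  | node l r _ ihr =>
    rw [count]
    cases r with
    | nil => simp [toList, factorCount, hu, count]
    | node l' r' =>
      have h : factorCount u (node l (node l' r')).toList.dropLast =
          (if u <+: (l :: (node l' r').toList).dropLast then 1 else 0) +
            factorCount u (node l' r').toList.dropLast := rfl
      have hsum : ((node l (node l' r')).toList.map (count u)).sum =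
          l.count u + ((node l' r').toList.map (count u)).sum := rfl
      rw [ihr, h, hsum]
      omega

lemma count_eq_zero {u : List Forest} {s : Forest} (hs : s ∈ u) {t : Forest}
    (ht : t.size ≤ s.size) : t.count u = 0 := by
  induction t with
  | nil => rfl
  | node l r ihl ihr =>
    have h : ¬ u <+: (l :: r.toList).dropLast := fun h => by
      have hmem : s ∈ (node l r).toList := List.mem_of_mem_dropLast (h.subset hs)
      exact absurd (size_lt_of_mem_toList hmem) (by omega)
    rw [size] at ht
    rw [count, ihl (by omega), ihr (by omega), if_neg h]

/-- Recursively reverse all sibling lists except for their last entries, leaving forests with at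
most `m` nodes unchanged; the first argument bounds the recursion depth. -/
def mirror (m : ℕ) : ℕ → Forest → Forest
  | 0, t => t
  | N + 1, t => if t.size ≤ m then t else ofList (reverseInit (t.toList.map (mirror m N)))

lemma size_mirror (m N : ℕ) (t : Forest) : (mirror m N t).size = t.size := by
  induction N generalizing t with
  | zero => rfl
  | succ N ih =>
    rw [mirror]
    split_ifs with h
    · rfl
    · rw [size_eq_sum, toList_ofList, ((reverseInit_perm _).map _).sum_eq, size_eq_sum t]
      simp [Function.comp_def, ih]

lemma mirror_involutive (m N : ℕ) : Function.Involutive (mirror m N) := by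
  intro t
  induction N generalizing t with
  | zero => rfl
  | succ N ih =>
    have hs := size_mirror m (N + 1) t
    rw [mirror, hs]
    split_ifs with h
    · simp [mirror, h]
    · rw [mirror, if_neg h, toList_ofList, ← reverseInit_map, reverseInit_reverseInit]
      simp [Function.comp_def, ih _]

lemma mirror_of_size_le {m : ℕ} (N : ℕ) {t : Forest} (h : t.size ≤ m) : mirror m N t = t := by
  cases N <;> simp [mirror, h]

lemma count_mirror {u : List Forest} {s : Forest} (hs : s ∈ u) (hu : ∀ c ∈ u, c.size ≤ s.size)
    (N : ℕ) {t : Forest} (ht : t.size ≤ N) :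
    (mirror s.size N t).count u.reverse = t.count u := by
  have hne : u ≠ [] := List.ne_nil_of_mem hs
  induction N generalizing t with
  | zero =>
    rw [mirror, count_eq_zero (List.mem_reverse.2 hs) (by omega), count_eq_zero hs (by omega)]
  | succ N ih =>
    rw [mirror]
    split_ifs with h
    · rw [count_eq_zero (List.mem_reverse.2 hs) h, count_eq_zero hs h]
    · have hmap : u.map (mirror s.size N) = u :=
        (List.map_congr_left fun c hc => mirror_of_size_le N (hu c hc)).trans (List.map_id u)
      rw [count_eq_sum (by simpa using hne), count_eq_sum hne, toList_ofList,
        ((reverseInit_perm _).map _).sum_eq, dropLast_reverseInit, factorCount_reverse hne,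
        ← List.map_dropLast, factorCount_map (mirror_involutive _ _).injective hmap, List.map_map]
      congr 2
      refine List.map_congr_left fun c hc => ih ?_
      have := size_lt_of_mem_toList hc
      omega

end Forest

/-! ### Restricted growth relative to a next fresh letter -/

/-- The next fresh letter after reading a word, starting with fresh letter `f`. -/
def nextFresh (f : ℕ) : List ℕ → ℕ
  | [] => f
  | c :: l => nextFresh (max f (c + 1)) l

/-- Every letter is at most the fresh letter at that point. -/
def Growth (f : ℕ) : List ℕ → Prop
  | [] => True
  | c :: l => c ≤ f ∧ Growth (max f (c + 1)) l

lemma le_nextFresh (f : ℕ) (l : List ℕ) : f ≤ nextFresh f l := by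
  induction l generalizing f with
  | nil => exact le_rfl
  | cons c l ih => exact (le_max_left _ _).trans (ih _)

lemma lt_nextFresh {f y : ℕ} {l : List ℕ} (h : y ∈ l) : y < nextFresh f l := by
  induction l generalizing f with
  | nil => simp at h
  | cons c l ih =>
    rcases List.mem_cons.1 h with rfl | h
    · exact lt_of_lt_of_le (Nat.lt_succ_self y) ((le_max_right _ _).trans (le_nextFresh _ l))
    · exact ih h

lemma nextFresh_map_add (f c : ℕ) (l : List ℕ) :
    nextFresh (f + c) (l.map (· + c)) = nextFresh f l + c := by
  induction l generalizing f with
  | nil => rfl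
  | cons d l ih =>
    simp only [List.map_cons, nextFresh]
    rw [← ih]
    congr 1
    omega

lemma growth_append {f : ℕ} {l l' : List ℕ} :
    Growth f (l ++ l') ↔ Growth f l ∧ Growth (nextFresh f l) l' := by
  induction l generalizing f with
  | nil => simp [Growth, nextFresh]
  | cons c l ih => simp [Growth, nextFresh, ih, and_assoc]

lemma mem_of_growth {f y : ℕ} {l : List ℕ} (h : Growth f l) (hy : f ≤ y)
    (hy' : y < nextFresh f l) : y ∈ l := by
  induction l generalizing f with
  | nil => simp only [nextFresh] at hy'; omega
  | cons c l ih =>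
    by_cases hc : y = c
    · simp [hc]
    · exact List.mem_cons_of_mem _ (ih h.2 (by have := h.1; omega) hy')

lemma growth_iff (M : ℕ) (l : List ℕ) :
    Growth (M + 1) l ↔
      ∀ i < l.length, l.getD i 0 ≤ max M ((l.take i).foldr max 0) + 1 := by
  induction l generalizing M with
  | nil => simp [Growth]
  | cons c l ih =>
    have hM : max (M + 1) (c + 1) = max M c + 1 := by omega
    rw [Growth, hM, ih]
    constructor
    · rintro ⟨h0, h⟩ (_ | i) hi
      · simpa using h0
      · simpa [max_assoc] using h i (by simpa using hi)
    · intro h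
      refine ⟨by simpa using h 0 (by simp), fun i hi => ?_⟩
      simpa [max_assoc] using h (i + 1) (by simpa using hi)

lemma isRGS_iff (l : List ℕ) :
    IsRGS l ↔ l.getD 0 1 = 1 ∧ (∀ x ∈ l, 1 ≤ x) ∧ Growth 1 l := by
  rw [IsRGS, ← zero_add 1, growth_iff]
  refine and_congr_right fun h0 => and_congr_right fun _ => ⟨fun h i hi => ?_, fun h i hi => ?_⟩
  · cases i with
    | zero =>
      cases l with
      | nil => simp at hi
      | cons c l => simp at h0; simp [h0]
    | succ i => simpa using h i hi
  · simpa using h (i + 1) hi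

/-! ### Crossings as sublists -/

lemma cons_sublist_drop_iff {c : ℕ} {s l : List ℕ} {n : ℕ} :
    (c :: s).Sublist (l.drop n) ↔
      ∃ i, n ≤ i ∧ i < l.length ∧ l.getD i 0 = c ∧ s.Sublist (l.drop (i + 1)) := by
  constructor
  · intro h
    induction hd : l.length - n generalizing n with
    | zero =>
      rw [List.drop_eq_nil_of_le (by omega)] at h
      simp at h
    | succ d ih =>
      have hn : n < l.length := by omega
      rw [List.drop_eq_getElem_cons hn] at h
      rcases List.cons_sublist_cons'.1 h with h | ⟨rfl, h⟩
      · obtain ⟨i, hi, h⟩ := ih h (by omega)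
        exact ⟨i, by omega, h⟩
      · rw [List.cons_sublist_cons] at h
        exact ⟨n, le_rfl, hn, by simp [hn], h⟩
  · rintro ⟨i, hni, hi, rfl, hs⟩
    have h : (l.getD i 0 :: s).Sublist (l.drop i) := by
      rw [List.drop_eq_getElem_cons hi, List.getD_eq_getElem _ _ hi]
      exact hs.cons_cons _
    exact h.trans (List.drop_sublist_drop_left l hni)

lemma crossing_iff (l : List ℕ) : Crossing l ↔ ∃ p q, p < q ∧ [p, q, p, q].Sublist l := by
  have key : ∀ p q, [p, q, p, q].Sublist l ↔ [p, q, p, q].Sublist (l.drop 0) := by simp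
  simp only [key, cons_sublist_drop_iff]
  constructor
  · rintro ⟨i, j, k, m, hij, hjk, hkm, hm, h1, h2, h3⟩
    exact ⟨_, _, h3, i, by omega, by omega, rfl, j, by omega, by omega, rfl, k, by omega,
      by omega, h1.symm, m, by omega, hm, h2.symm, by simp⟩
  · rintro ⟨p, q, hpq, i, -, -, hp, j, hij, -, hq, k, hjk, -, hp', m, hkm, hm, hq', -⟩
    exact ⟨i, j, k, m, by omega, by omega, by omega, hm, by omega, by omega, by omega⟩

lemma not_crossing_of_sublist {l l' : List ℕ} (h : l.Sublist l') (h' : ¬ Crossing l') :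
    ¬ Crossing l := by
  rw [crossing_iff] at *
  rintro ⟨p, q, hpq, hs⟩
  exact h' ⟨p, q, hpq, hs.trans h⟩

/-! ### The word of a forest -/

namespace Forest

/-- The sequence of a forest whose roots carry the letter `x`, where `f` is the next fresh
letter. -/
def word (x f : ℕ) : Forest → List ℕ
  | nil => []
  | node l r => x :: (word f (f + 1) l ++ word x (nextFresh f (word f (f + 1) l)) r)

lemma length_word (x f : ℕ) (t : Forest) : (word x f t).length = t.size := by
  induction t generalizing x f with
  | nil => rfl
  | node l r ihl ihr => simp [word, size, ihl, ihr]

lemma mem_word {x f y : ℕ} {t : Forest} (h : y ∈ word x f t) : y = x ∨ f ≤ y := by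
  induction t generalizing x f with
  | nil => simp [word] at h
  | node l r ihl ihr =>
    rw [word, List.mem_cons, List.mem_append] at h
    rcases h with h | h | h
    · exact Or.inl h
    · have := ihl h
      omega
    · have := ihr h
      have := le_nextFresh f (word f (f + 1) l)
      omega

lemma le_of_mem_word_succ {f y : ℕ} {t : Forest} (h : y ∈ word f (f + 1) t) : f ≤ y := by
  have := mem_word h
  omega

lemma word_eq_nil_or_cons (x f : ℕ) (t : Forest) :
    word x f t = [] ∨ ∃ l, word x f t = x :: l := by
  cases t <;> simp [word]

lemma word_add (x f c : ℕ) (t : Forest) :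
    word (x + c) (f + c) t = (word x f t).map (· + c) := by
  induction t generalizing x f with
  | nil => rfl
  | node l r ihl ihr =>
    have h := ihl f (f + 1)
    rw [add_right_comm] at h
    simp [word, h, nextFresh_map_add, ihr]

lemma growth_word_of_succ {f : ℕ} {t : Forest} (h : Growth (f + 1) (word f (f + 1) t)) :
    Growth f (word f (f + 1) t) := by
  cases t with
  | nil => trivial
  | node l r => simpa [word, Growth] using h

lemma growth_word {x f : ℕ} (hx : x < f) (t : Forest) : Growth f (word x f t) := by
  induction t generalizing x f with
  | nil => trivial
  | node l r ihl ihr =>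
    rw [word, Growth, max_eq_left (by omega), growth_append]
    exact ⟨hx.le, growth_word_of_succ (ihl (by omega)),
      ihr (lt_of_lt_of_le hx (le_nextFresh _ _))⟩

lemma not_crossing_word {x f : ℕ} (hx : x < f) (t : Forest) : ¬ Crossing (word x f t) := by
  induction t generalizing x f with
  | nil => simp [word, crossing_iff]
  | node l r ihl ihr =>
    have hA := ihl (x := f) (f := f + 1) (by omega)
    have hxg := lt_of_lt_of_le hx (le_nextFresh f (word f (f + 1) l))
    have hB := ihr hxg
    have hBx := word_eq_nil_or_cons x (nextFresh f (word f (f + 1) l)) r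
    have hmA : ∀ y ∈ word f (f + 1) l, f ≤ y ∧ y < nextFresh f (word f (f + 1) l) :=
      fun y hy => ⟨le_of_mem_word_succ hy, lt_nextFresh hy⟩
    have hmB : ∀ y ∈ word x (nextFresh f (word f (f + 1) l)) r,
        y = x ∨ nextFresh f (word f (f + 1) l) ≤ y := fun y hy => mem_word hy
    rw [word]
    generalize word x (nextFresh f (word f (f + 1) l)) r = B at *
    generalize nextFresh f (word f (f + 1) l) = g at *
    generalize word f (f + 1) l = A at *
    have hdisj : ∀ y, y ∈ A → y ∈ B → False := fun y h1 h2 => by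
      have := hmA y h1
      have := hmB y h2
      omega
    rw [crossing_iff] at *
    rintro ⟨p, q, hpq, h⟩
    rcases List.cons_sublist_cons'.1 h with h | ⟨rfl, h⟩
    on_goal 2 => rw [List.cons_sublist_cons] at h
    · obtain ⟨s₁, s₂, hs, h₁, h₂⟩ := List.sublist_append_iff.1 h
      rcases s₁ with _ | ⟨c₁, _ | ⟨c₂, _ | ⟨c₃, _ | ⟨c₄, s⟩⟩⟩⟩
      · exact hB ⟨p, q, hpq, by simpa [hs] using h₂⟩
      · simp at hs
        exact hdisj p (h₁.subset (by simp [hs])) (h₂.subset (by simp [← hs.2]))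
      · simp at hs
        exact hdisj p (h₁.subset (by simp [hs])) (h₂.subset (by simp [← hs.2.2]))
      · simp at hs
        exact hdisj q (h₁.subset (by simp [hs])) (h₂.subset (by simp [← hs.2.2.2]))
      · simp at hs
        obtain ⟨rfl, rfl, rfl, rfl, rfl, rfl⟩ := hs
        exact hA ⟨_, _, hpq, h₁⟩
    · obtain ⟨s₁, s₂, hs, h₁, h₂⟩ := List.sublist_append_iff.1 h
      rcases s₁ with _ | ⟨c₁, _ | ⟨c₂, s⟩⟩
      · rw [List.nil_append] at hs
        rw [← hs] at h₂
        rcases hBx with rfl | ⟨B', rfl⟩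
        · simp at h₂
        · rcases List.cons_sublist_cons'.1 h₂ with h₂ | ⟨rfl, -⟩
          · exact hB ⟨_, _, hpq, h₂.cons_cons _⟩
          · omega
      · simp at hs
        exact hdisj q (h₁.subset (by simp [hs])) (h₂.subset (by simp [← hs.2]))
      · simp at hs
        have := hmA p (h₁.subset (by simp [hs]))
        omega

lemma exists_word_eq {x f : ℕ} (hx : x < f) {l : List ℕ} (hl : ∀ y ∈ l, y = x ∨ f ≤ y)
    (h0 : l.getD 0 x = x) (hg : Growth f l) (hc : ¬ Crossing l) : ∃ t, word x f t = l := by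
  induction hn : l.length using Nat.strong_induction_on generalizing x f l with
  | _ n ih =>
    cases l with
    | nil => exact ⟨nil, rfl⟩
    | cons c l =>
      obtain rfl : c = x := by simpa using h0
      obtain ⟨A, B, rfl, hA, hB⟩ : ∃ A B, l = A ++ B ∧ c ∉ A ∧ B.getD 0 c = c := by
        refine ⟨l.takeWhile (· ≠ c), l.dropWhile (· ≠ c), List.takeWhile_append_dropWhile.symm,
          fun h => by simpa using List.mem_takeWhile_imp h, ?_⟩
        have hd := List.head_dropWhile_not (fun y => decide (y ≠ c)) (l := l)
        generalize l.dropWhile (· ≠ c) = B at *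
        cases B with
        | nil => rfl
        | cons d B => exact not_not.1 (of_decide_eq_false (hd (by simp)))
      rw [Growth, max_eq_left (by omega), growth_append] at hg
      have hAf : ∀ y ∈ A, f ≤ y := fun y hy =>
        (hl y (by simp [hy])).resolve_left (fun h => hA (h ▸ hy))
      have hA0 : A.getD 0 f = f ∧ Growth (f + 1) A := by
        cases A with
        | nil => exact ⟨rfl, trivial⟩
        | cons d A =>
          obtain rfl : d = f := le_antisymm hg.2.1.1 (hAf d (by simp))
          have := hg.2.1.2
          simpa [Growth] using this
      have hlen : A.length + B.length + 1 = n := by simpa using hn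
      obtain ⟨s, rfl⟩ := ih A.length (by omega) (Nat.lt_succ_self f)
        (fun y hy => by have := hAf y hy; omega) hA0.1 hA0.2
        (not_crossing_of_sublist ((List.sublist_append_left A B).cons c) hc) rfl
      have hBg : ∀ y ∈ B, y = c ∨ nextFresh f (word f (f + 1) s) ≤ y := by
        intro y hy
        by_contra! hcon
        have hyf := (hl y (by simp [hy])).resolve_left hcon.1
        have hyA := mem_of_growth hg.2.1 hyf hcon.2
        apply hc
        rw [crossing_iff]
        refine ⟨c, y, by omega, List.Sublist.cons_cons _ ?_⟩
        change ([y] ++ [c, y]).Sublist _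
        refine (List.singleton_sublist.2 hyA).append ?_
        cases B with
        | nil => simp at hy
        | cons d B =>
          obtain rfl : d = c := by simpa using hB
          refine List.Sublist.cons_cons _ (List.singleton_sublist.2 ?_)
          exact (List.mem_cons.1 hy).resolve_left hcon.1
      obtain ⟨t, rfl⟩ := ih B.length (by omega) (lt_of_lt_of_le hx (le_nextFresh _ _)) hBg hB
        hg.2.2 (not_crossing_of_sublist ((List.sublist_append_right _ B).cons c) hc) rfl
      exact ⟨node s t, rfl⟩

lemma ncseq_iff {n : ℕ} {l : List ℕ} : NCseq n l ↔ ∃ t : Forest, t.size = n ∧ word 1 2 t = l := by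
  rw [NCseq, isRGS_iff]
  constructor
  · rintro ⟨hn, ⟨h0, hpos, hg⟩, hc⟩
    have hg2 : Growth 2 l := by
      cases l with
      | nil => trivial
      | cons c l =>
        obtain rfl : c = 1 := by simpa using h0
        simpa [Growth] using hg
    obtain ⟨t, rfl⟩ := exists_word_eq one_lt_two
      (fun y hy => by have := hpos y hy; omega) h0 hg2 hc
    exact ⟨t, by rw [← hn, length_word], rfl⟩
  · rintro ⟨t, rfl, rfl⟩
    refine ⟨length_word _ _ _, ⟨?_, fun y hy => le_of_mem_word_succ hy,
      growth_word_of_succ (growth_word one_lt_two t)⟩, not_crossing_word one_lt_two t⟩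
    cases t <;> simp [word]

end Forest

/-! ### Order isomorphism -/

lemma ordIso_append {s s' t t' : List ℕ} (h : OrdIso (s ++ s') (t ++ t'))
    (hl : s.length = t.length) : OrdIso s t ∧ OrdIso s' t' := by
  have hlen : s'.length = t'.length := by
    have := h.1
    simp at this
    omega
  refine ⟨⟨hl, fun j k hj hk => ?_⟩, hlen, fun j k hj hk => ?_⟩
  · have := h.2 j k (by simp; omega) (by simp; omega)
    rwa [List.getD_append _ _ _ _ hj, List.getD_append _ _ _ _ hk,
      List.getD_append _ _ _ _ (hl ▸ hj), List.getD_append _ _ _ _ (hl ▸ hk)] at this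
  · have := h.2 (s.length + j) (s.length + k) (by simp; omega) (by simp; omega)
    rwa [List.getD_append_right _ _ _ _ (by omega), List.getD_append_right _ _ _ _ (by omega),
      List.getD_append_right _ _ _ _ (by omega), List.getD_append_right _ _ _ _ (by omega),
      ← hl, Nat.add_sub_cancel_left, Nat.add_sub_cancel_left] at this

lemma ordIso_refl (s : List ℕ) : OrdIso s s := ⟨rfl, fun _ _ _ _ => Iff.rfl⟩

lemma ordIso_symm {s t : List ℕ} (h : OrdIso s t) : OrdIso t s :=
  ⟨h.1.symm, fun j k hj hk => (h.2 j k (h.1 ▸ hj) (h.1 ▸ hk)).symm⟩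

lemma ordIso_map_add (s : List ℕ) (c : ℕ) : OrdIso s (s.map (· + c)) := by
  refine ⟨by simp, fun j k hj hk => ?_⟩
  simp [hj, hk]

namespace Forest

lemma length_le_of_ordIso {x f y g : ℕ} (hg : y < g) {l l' r r' : Forest}
    (h : OrdIso (word x f (node l r)) (word y g (node l' r'))) : l'.size ≤ l.size := by
  by_contra! hlt
  have hlen := h.1
  simp only [length_word, size] at hlen
  have hB : ∃ B, word x (nextFresh f (word f (f + 1) l)) r = x :: B := by
    refine (word_eq_nil_or_cons _ _ _).resolve_left fun h0 => ?_
    have := length_word x (nextFresh f (word f (f + 1) l)) r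
    rw [h0] at this
    simp at this
    omega
  obtain ⟨B, hB⟩ := hB
  have hl' : l.size < (word g (g + 1) l').length := by rw [length_word]; omega
  have := h.2 0 (l.size + 1) (by simp [length_word, size]) (by simp [length_word, size]; omega)
  rw [word, word, hB, List.getD_cons_succ, List.getD_cons_succ, List.getD_cons_zero,
    List.getD_cons_zero, List.getD_append_right _ _ _ _ (by simp [length_word]), length_word,
    Nat.sub_self, List.getD_cons_zero, List.getD_append _ _ _ _ hl',
    List.getD_eq_getElem _ _ hl'] at this
  have hge := le_of_mem_word_succ (List.getElem_mem hl')
  exact absurd (this.2 (by omega)) (lt_irrefl x)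

lemma eq_of_ordIso_word {x f y g : ℕ} (hf : x < f) (hg : y < g) {t t' : Forest}
    (h : OrdIso (word x f t) (word y g t')) : t = t' := by
  induction t generalizing x f y g t' with
  | nil =>
    cases t' with
    | nil => rfl
    | node l' r' =>
      have := h.1
      simp [word] at this
  | node l r ihl ihr =>
    cases t' with
    | nil =>
      have := h.1
      simp [word] at this
    | node l' r' =>
      have hl : l.size = l'.size :=
        le_antisymm (length_le_of_ordIso hf (ordIso_symm h)) (length_le_of_ordIso hg h)
      have h' := (ordIso_append (s := [x]) (t := [y]) h rfl).2
      obtain ⟨h1, h2⟩ := ordIso_append h' (by simpa [length_word] using hl)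
      rw [ihl (by omega) (by omega) h1, ihr (lt_of_lt_of_le hf (le_nextFresh _ _))
        (lt_of_lt_of_le hg (le_nextFresh _ _)) h2]

lemma ordIso_word_iff {f : ℕ} (hf : 1 ≤ f) {s t : Forest} :
    OrdIso (word 1 2 s) (word f (f + 1) t) ↔ t = s := by
  refine ⟨fun h => (eq_of_ordIso_word (by omega) (by omega) h).symm, ?_⟩
  rintro rfl
  obtain ⟨c, rfl⟩ := Nat.exists_eq_add_of_le hf
  have := word_add 1 2 c t
  rw [show 1 + c + 1 = 2 + c by omega, this]
  exact ordIso_map_add _ _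

end Forest

/-! ### Occurrences of the pattern -/

/-- The subword pattern `1^a (ρ+1) 1^b`. -/
abbrev hatPattern (a b : ℕ) (ρ : List ℕ) : List ℕ :=
  List.replicate a 1 ++ ρ.map (· + 1) ++ List.replicate b 1

lemma length_of_occAt {τ l : List ℕ} {i : ℕ} (h : occAt τ l i) : i + τ.length ≤ l.length ∨
    τ = [] := by
  have := h.1
  simp at this
  rcases τ with _ | ⟨c, τ⟩
  · exact Or.inr rfl
  · simp at this ⊢
    omega

lemma occCount_nil {τ : List ℕ} (hτ : τ ≠ []) : occCount τ [] = 0 := by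
  have : IsEmpty {i : ℕ // occAt τ [] i} := ⟨fun ⟨i, hi⟩ => by
    have h := (length_of_occAt hi).resolve_right hτ
    have := List.length_pos_iff.2 hτ
    rw [List.length_nil] at h
    omega⟩
  exact Nat.card_of_isEmpty

lemma finite_occAt {τ : List ℕ} (hτ : τ ≠ []) (l : List ℕ) : {i | occAt τ l i}.Finite :=
  (Set.finite_Iic l.length).subset fun i hi => by
    have h := (length_of_occAt hi).resolve_right hτ
    simp only [Set.mem_Iic]
    omega

open scoped Classical in
lemma occCount_cons {τ : List ℕ} (hτ : τ ≠ []) (c : ℕ) (l : List ℕ) :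
    occCount τ (c :: l) = (if occAt τ (c :: l) 0 then 1 else 0) + occCount τ l := by
  have hsucc : Nat.succ '' {i | occAt τ l i} = {i | occAt τ (c :: l) i} \ {0} := by
    ext i
    cases i with
    | zero => simp
    | succ i => simp [occAt]
  have hcard : ({i | occAt τ (c :: l) i} \ {0}).ncard = {i | occAt τ l i}.ncard := by
    rw [← hsucc, Set.ncard_image_of_injective _ Nat.succ_injective]
  change {i | occAt τ (c :: l) i}.ncard = _ + {i | occAt τ l i}.ncard
  rw [← hcard]
  split_ifs with h
  · have h' : 0 ∈ {i | occAt τ (c :: l) i} := h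
    rw [add_comm, Set.ncard_sdiff_singleton_add_one h' (finite_occAt hτ _)]
  · have h' : 0 ∉ {i | occAt τ (c :: l) i} := h
    rw [Set.sdiff_singleton_eq_self h', zero_add]

lemma occAt_zero_append {τ : List ℕ} {p : ℕ} (hτ : ∀ j < τ.length, τ.getD 0 0 ≤ τ.getD j 0)
    {x : ℕ} {A B : List ℕ} (hp : A = p :: A.tail) (hA : ∀ y ∈ A, x < y) (hB : B.getD 0 x = x) :
    occAt τ (A ++ B) 0 ↔ occAt τ A 0 := by
  rw [occAt, occAt, List.drop_zero, List.drop_zero]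
  by_cases hlen : τ.length ≤ A.length
  · rw [List.take_append_of_le_length hlen]
  · push Not at hlen
    refine iff_of_false (fun h => ?_) (fun h => ?_)
    · have hl := h.1
      simp at hl
      have hm := h.2 A.length 0 hlen (by omega)
      have hx : x < p := hA p (by rw [hp]; simp)
      cases B with
      | nil => simp at hl; omega
      | cons d B =>
        obtain rfl : d = x := by simpa using hB
        have h1 : ((A ++ d :: B).take τ.length).getD A.length 0 = d := by
          simp [List.getD_eq_getElem?_getD, hlen]
        have h2 : ((A ++ d :: B).take τ.length).getD 0 0 = p := by
          rw [hp]
          simp [List.getD_eq_getElem?_getD, show 0 < τ.length by omega]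
        rw [h1, h2] at hm
        have := hτ A.length hlen
        have := hm.2 hx
        omega
    · have hl := h.1
      simp at hl
      omega

open scoped Classical in
lemma occCount_append {τ : List ℕ} (hne : τ ≠ [])
    (hτ : ∀ j < τ.length, τ.getD 0 0 ≤ τ.getD j 0) {x : ℕ} {A B : List ℕ}
    (hA : ∀ y ∈ A, x < y) (hB : B.getD 0 x = x) :
    occCount τ (A ++ B) = occCount τ A + occCount τ B := by
  induction A with
  | nil => simp [occCount_nil hne]
  | cons c A ih =>
    have h := occAt_zero_append hτ (p := c) rfl hA hB
    rw [List.cons_append] at h ⊢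
    rw [occCount_cons hne, occCount_cons hne, ih fun y hy => hA y (by simp [hy])]
    rw [if_congr h rfl rfl, add_assoc]

lemma getD_replicate_append (a b x : ℕ) (w : List ℕ) {j : ℕ} (hj : j < a + w.length + b) :
    (List.replicate a x ++ w ++ List.replicate b x).getD j 0 =
      if a ≤ j ∧ j < a + w.length then w.getD (j - a) 0 else x := by
  rcases lt_or_ge j a with h | h
  · rw [List.append_assoc, List.getD_append _ _ _ _ (by simpa using h)]
    simp [h, Nat.not_le.2 h]
  · rcases lt_or_ge j (a + w.length) with h' | h'
    · rw [List.getD_append _ _ _ _ (by simpa using h'),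
        List.getD_append_right _ _ _ _ (by simpa using h)]
      simp [h, h']
    · rw [List.getD_append_right _ _ _ _ (by simpa using h')]
      have : j - (a + w.length) < b := by omega
      simp [this, Nat.not_lt.2 h']

lemma length_hatPattern (a b : ℕ) (ρ : List ℕ) :
    (hatPattern a b ρ).length = a + ρ.length + b := by
  simp [hatPattern, add_assoc]

lemma getD_hatPattern (a b : ℕ) (ρ : List ℕ) {j : ℕ} (hj : j < a + ρ.length + b) :
    (hatPattern a b ρ).getD j 0 =
      if a ≤ j ∧ j < a + ρ.length then ρ.getD (j - a) 0 + 1 else 1 := by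
  rw [hatPattern, getD_replicate_append _ _ _ _ (by simpa using hj), List.length_map]
  split_ifs with h
  · have : j - a < ρ.length := by omega
    simp [this]
  · rfl

lemma hatPattern_min {a : ℕ} (ha : 1 ≤ a) (b : ℕ) (ρ : List ℕ) (j : ℕ)
    (hj : j < (hatPattern a b ρ).length) :
    (hatPattern a b ρ).getD 0 0 ≤ (hatPattern a b ρ).getD j 0 := by
  rw [length_hatPattern] at hj
  rw [getD_hatPattern _ _ _ hj, getD_hatPattern _ _ _ (by omega), if_neg (by omega)]
  split_ifs <;> omega

lemma ordIso_hatPattern_iff {a b x : ℕ} (ha : 1 ≤ a) {ρ s : List ℕ} (hρ : ∀ y ∈ ρ, 1 ≤ y)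
    (hs : s.getD 0 0 = x) :
    OrdIso (hatPattern a b ρ) s ↔
      ∃ w, s = List.replicate a x ++ w ++ List.replicate b x ∧ (∀ y ∈ w, x < y) ∧ OrdIso ρ w := by
  have hpos : ∀ i < ρ.length, 1 ≤ ρ.getD i 0 := fun i hi => by
    rw [List.getD_eq_getElem _ _ hi]
    exact hρ _ (List.getElem_mem hi)
  constructor
  · rintro ⟨hlen, h⟩
    rw [length_hatPattern] at hlen h
    have hw : ((s.drop a).take ρ.length).length = ρ.length := by simp; omega
    have hget : ∀ i < ρ.length, ((s.drop a).take ρ.length).getD i 0 = s.getD (a + i) 0 :=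
      fun i hi => by
        simp [List.getD_eq_getElem?_getD, hi]
    refine ⟨(s.drop a).take ρ.length, List.ext_getElem (by simp; omega) fun j hj hj' => ?_,
      fun y hy => ?_, hw.symm, fun i j hi hj => ?_⟩
    · rw [← List.getD_eq_getElem _ 0 hj, ← List.getD_eq_getElem _ 0 hj',
        getD_replicate_append _ _ _ _ (by rw [hw]; omega), hw]
      split_ifs with hc
      · rw [hget _ (by omega), Nat.add_sub_cancel' hc.1]
      · have h1 := h 0 j (by omega) (by omega)
        have h2 := h j 0 (by omega) (by omega)
        rw [getD_hatPattern _ _ _ (by omega), getD_hatPattern _ _ _ (by omega), if_neg hc,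
          if_neg (by omega)] at h1 h2
        omega
    · obtain ⟨i, hi, rfl⟩ := List.getElem_of_mem hy
      rw [← List.getD_eq_getElem _ 0 hi, hget i (by omega), ← hs]
      rw [hw] at hi
      refine (h 0 (a + i) (by omega) (by omega)).1 ?_
      rw [getD_hatPattern _ _ _ (by omega), getD_hatPattern _ _ _ (by omega), if_neg (by omega),
        if_pos (by omega), Nat.add_sub_cancel_left]
      have := hpos i hi
      omega
    · rw [hget i hi, hget j hj, ← h (a + i) (a + j) (by omega) (by omega),
        getD_hatPattern _ _ _ (by omega), getD_hatPattern _ _ _ (by omega), if_pos (by omega),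
        if_pos (by omega), Nat.add_sub_cancel_left, Nat.add_sub_cancel_left, Nat.add_lt_add_iff_right]
  · rintro ⟨w, rfl, hw, hlen, h⟩
    have hwx : ∀ i < w.length, x < w.getD i 0 := fun i hi => by
      rw [List.getD_eq_getElem _ _ hi]
      exact hw _ (List.getElem_mem hi)
    refine ⟨by simp [hlen], fun i j hi hj => ?_⟩
    rw [length_hatPattern] at hi hj
    rw [getD_hatPattern _ _ _ hi, getD_hatPattern _ _ _ hj,
      getD_replicate_append _ _ _ _ (hlen ▸ hi), getD_replicate_append _ _ _ _ (hlen ▸ hj), ← hlen]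
    split_ifs with h1 h2 h2
    · rw [Nat.add_lt_add_iff_right]
      exact h _ _ (by omega) (by omega)
    · have := hwx (i - a) (by omega)
      omega
    · have := hwx (j - a) (by omega)
      have := hpos (j - a) (by omega)
      omega
    · omega

lemma occAt_hatPattern_zero_iff {a b x : ℕ} (ha : 1 ≤ a) {ρ l : List ℕ} (hρ : ∀ y ∈ ρ, 1 ≤ y) :
    occAt (hatPattern a b ρ) (x :: l) 0 ↔
      ∃ w, List.replicate a x ++ w ++ List.replicate b x <+: x :: l ∧ (∀ y ∈ w, x < y) ∧
        OrdIso ρ w := by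
  have h0 : ((x :: l).take (hatPattern a b ρ).length).getD 0 0 = x := by
    have : 0 < (hatPattern a b ρ).length := by rw [length_hatPattern]; omega
    rw [List.getD_eq_getElem?_getD, List.getElem?_take_of_lt this]
    rfl
  rw [occAt, List.drop_zero, ordIso_hatPattern_iff ha hρ h0]
  refine exists_congr fun w => and_congr_left fun hw => ?_
  have hlen : (hatPattern a b ρ).length =
      (List.replicate a x ++ w ++ List.replicate b x).length := by
    rw [length_hatPattern, hw.2.1]
    simp [add_assoc]
  rw [hlen, List.prefix_iff_eq_take, eq_comm]

lemma append_prefix_append_iff {x : ℕ} {w A B c : List ℕ} (hw : ∀ y ∈ w, x < y)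
    (hA : ∀ y ∈ A, x < y) (hB : B.getD 0 x = x) :
    w ++ x :: c <+: A ++ B ↔ w = A ∧ x :: c <+: B := by
  induction w generalizing A with
  | nil =>
    cases A with
    | nil => simp
    | cons d A =>
      have := hA d (by simp)
      simp [List.cons_prefix_cons, this.ne]
  | cons y w ih =>
    have hy := hw y (by simp)
    cases A with
    | nil =>
      cases B with
      | nil => simp
      | cons d B =>
        obtain rfl : d = x := by simpa using hB
        simp [List.cons_prefix_cons, hy.ne']
    | cons d A =>
      have := ih (fun z hz => hw z (by simp [hz])) (A := A) fun z hz => hA z (by simp [hz])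
      simp [List.cons_prefix_cons, this, and_assoc]

namespace Forest

lemma cons_prefix_dropLast_iff {c l r : Forest} {u : List Forest} :
    c :: u <+: (l :: r.toList).dropLast ↔ r ≠ nil ∧ c = l ∧ u <+: r.toList.dropLast := by
  cases r with
  | nil => simp [toList]
  | node l' r' => simp [toList, List.cons_prefix_cons]

lemma getD_word (x f : ℕ) (t : Forest) : (word x f t).getD 0 x = x := by
  cases t <;> simp [word]

lemma cons_prefix_word_append_iff {x f : ℕ} (hx : x < f) {l : Forest} {c B : List ℕ} :
    x :: c <+: word f (f + 1) l ++ B ↔ l = nil ∧ x :: c <+: B := by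
  cases l with
  | nil => simp [word]
  | node l r => simp [word, List.cons_prefix_cons, hx.ne]

lemma replicate_prefix_word_iff {x f : ℕ} (hx : x < f) {b : ℕ} {t : Forest} :
    List.replicate (b + 1) x <+: word x f t ↔
      t ≠ nil ∧ List.replicate b nil <+: t.toList.dropLast := by
  induction b generalizing t with
  | zero => cases t <;> simp [word]
  | succ b ih =>
    cases t with
    | nil => simp [word, List.replicate_succ]
    | node l r =>
      rw [List.replicate_succ, word, List.cons_prefix_cons, List.replicate_succ,
        cons_prefix_word_append_iff hx, ← List.replicate_succ, List.replicate_succ (a := nil),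
        toList, cons_prefix_dropLast_iff]
      constructor
      · rintro ⟨-, rfl, h⟩
        have := ih.1 h
        exact ⟨by simp, this.1, rfl, this.2⟩
      · rintro ⟨-, h, rfl, hp⟩
        exact ⟨rfl, rfl, ih.2 ⟨h, hp⟩⟩

/-- The sibling pattern corresponding to an occurrence of `1^(a+1) (ρ+1) 1^(b+1)`. -/
abbrev siblingPattern (a b : ℕ) (s : Forest) : List Forest :=
  List.replicate a nil ++ s :: List.replicate b nil

lemma siblingPattern_prefix_iff {a b x f : ℕ} (hx : x < f) {s t : Forest} :
    (∃ w, List.replicate (a + 1) x ++ w ++ List.replicate (b + 1) x <+: word x f t ∧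
        (∀ y ∈ w, x < y) ∧ OrdIso (word 1 2 s) w) ↔
      siblingPattern a b s <+: t.toList.dropLast := by
  induction a generalizing t with
  | zero =>
    cases t with
    | nil => simp [word, toList]
    | node l r =>
      have hA : ∀ y ∈ word f (f + 1) l, x < y := fun y hy =>
        lt_of_lt_of_le hx (le_of_mem_word_succ hy)
      have hxg := lt_of_lt_of_le hx (le_nextFresh f (word f (f + 1) l))
      have key : ∀ w, (∀ y ∈ w, x < y) →
          (List.replicate (0 + 1) x ++ w ++ List.replicate (b + 1) x <+: word x f (node l r) ↔
            w = word f (f + 1) l ∧ r ≠ nil ∧ List.replicate b nil <+: r.toList.dropLast) := by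
        intro w hw
        rw [← replicate_prefix_word_iff hxg, List.replicate_succ (n := b),
          ← append_prefix_append_iff hw hA (getD_word _ _ _)]
        simp [word, List.cons_prefix_cons]
      simp only [siblingPattern, List.replicate_zero, List.nil_append, toList,
        cons_prefix_dropLast_iff]
      constructor
      · rintro ⟨w, h, hw, ho⟩
        obtain ⟨rfl, hr, hp⟩ := (key w hw).1 h
        exact ⟨hr, ((ordIso_word_iff (by omega)).1 ho).symm, hp⟩
      · rintro ⟨hr, rfl, hp⟩
        exact ⟨_, (key _ hA).2 ⟨rfl, hr, hp⟩, hA, (ordIso_word_iff (by omega)).2 rfl⟩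
  | succ a ih =>
    cases t with
    | nil => simp [word, toList, List.replicate_succ]
    | node l r =>
      have key : ∀ w, List.replicate (a + 1 + 1) x ++ w ++ List.replicate (b + 1) x <+:
          word x f (node l r) ↔ l = nil ∧
            List.replicate (a + 1) x ++ w ++ List.replicate (b + 1) x <+: word x f r := by
        intro w
        rw [List.replicate_succ, word, List.cons_append, List.cons_append, List.cons_prefix_cons,
          List.replicate_succ, List.cons_append, List.cons_append, cons_prefix_word_append_iff hx]
        constructor
        · rintro ⟨-, rfl, h⟩
          exact ⟨rfl, h⟩
        · rintro ⟨rfl, h⟩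
          exact ⟨rfl, rfl, h⟩
      simp only [key, and_assoc, exists_and_left, ih]
      rw [toList, siblingPattern, siblingPattern, List.replicate_succ, List.cons_append,
        cons_prefix_dropLast_iff]
      constructor
      · rintro ⟨rfl, h⟩
        refine ⟨?_, rfl, h⟩
        rintro rfl
        simp [toList] at h
      · rintro ⟨-, rfl, h⟩
        exact ⟨rfl, h⟩

open scoped Classical in
lemma occCount_word (a b : ℕ) (s : Forest) {x f : ℕ} (hx : x < f) (t : Forest) :
    occCount (hatPattern (a + 1) (b + 1) (word 1 2 s)) (word x f t) =
      t.count (siblingPattern a b s) := by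
  have hne : hatPattern (a + 1) (b + 1) (word 1 2 s) ≠ [] := by simp [hatPattern]
  induction t generalizing x f with
  | nil => exact occCount_nil hne
  | node l r ihl ihr =>
    have hocc := (occAt_hatPattern_zero_iff (a := a + 1) (b := b + 1) (x := x)
      (l := word f (f + 1) l ++ word x (nextFresh f (word f (f + 1) l)) r) (by omega)
      (fun y (hy : y ∈ word 1 2 s) => le_of_mem_word_succ hy)).trans
      (siblingPattern_prefix_iff (t := node l r) hx)
    rw [word, occCount_cons hne, occCount_append hne (hatPattern_min (by omega) _ _)
      (fun y hy => lt_of_lt_of_le hx (le_of_mem_word_succ hy)) (getD_word _ _ _),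
      ihl (Nat.lt_succ_self f), ihr (lt_of_lt_of_le hx (le_nextFresh _ _)), count, add_comm]
    congr 1
    exact if_congr hocc rfl rfl

lemma reverse_siblingPattern (a b : ℕ) (s : Forest) :
    (siblingPattern a b s).reverse = siblingPattern b a s := by
  simp [siblingPattern]

lemma card_ncseq_occCount (a b n k : ℕ) (s : Forest) :
    Nat.card {l : List ℕ // NCseq n l ∧
        occCount (hatPattern (a + 1) (b + 1) (word 1 2 s)) l = k} =
      Nat.card {t : Forest // t.size = n ∧ t.count (siblingPattern a b s) = k} := by
  symm
  refine Nat.card_congr (Equiv.ofBijective (fun t => ⟨word 1 2 t.1,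
    ncseq_iff.2 ⟨t.1, t.2.1, rfl⟩, (occCount_word a b s one_lt_two t.1).trans t.2.2⟩) ⟨?_, ?_⟩)
  · intro t t' h
    have h' : word 1 2 t.1 = word 1 2 t'.1 := congrArg Subtype.val h
    exact Subtype.ext (eq_of_ordIso_word one_lt_two one_lt_two (h' ▸ ordIso_refl _))
  · rintro ⟨l, hl, hk⟩
    obtain ⟨t, ht, rfl⟩ := ncseq_iff.1 hl
    exact ⟨⟨t, ht, (occCount_word a b s one_lt_two t).symm.trans hk⟩, rfl⟩

lemma card_count_siblingPattern_comm (a b n k : ℕ) (s : Forest) :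
    Nat.card {t : Forest // t.size = n ∧ t.count (siblingPattern a b s) = k} =
      Nat.card {t : Forest // t.size = n ∧ t.count (siblingPattern b a s) = k} := by
  refine Nat.card_congr ((Function.Involutive.toPerm _ (mirror_involutive s.size n)).subtypeEquiv
    fun t => ?_)
  rw [Function.Involutive.coe_toPerm, size_mirror]
  refine and_congr_right fun ht => ?_
  rw [← reverse_siblingPattern a b, count_mirror (by simp [siblingPattern]) _ _ ht.le]
  intro c hc
  simp only [siblingPattern, List.mem_append, List.mem_cons, List.mem_replicate] at hc
  rcases hc with ⟨-, rfl⟩ | rfl | ⟨-, rfl⟩ <;> simp [size]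

end Forest

/-- The subwords 1^a(ρ+1)1^b and 1^b(ρ+1)1^a are equidistributed on NC_n,
where ρ is a non-crossing canonical form of length m ≥ 1 and a, b ≥ 1. -/
theorem stmt12 (m a b n k : ℕ) (ρ : List ℕ) (hm : 1 ≤ m) (ha : 1 ≤ a)
    (hb : 1 ≤ b) (hρ : NCseq m ρ) :
    Nat.card {l : List ℕ // NCseq n l ∧
        occCount (List.replicate a 1 ++ ρ.map (· + 1) ++ List.replicate b 1) l = k} =
      Nat.card {l : List ℕ // NCseq n l ∧
        occCount (List.replicate b 1 ++ ρ.map (· + 1) ++ List.replicate a 1) l = k} := by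
  obtain ⟨s, -, rfl⟩ := Forest.ncseq_iff.1 hρ
  obtain ⟨a, rfl⟩ := Nat.exists_eq_add_of_le' ha
  obtain ⟨b, rfl⟩ := Nat.exists_eq_add_of_le' hb
  exact (Forest.card_ncseq_occCount a b n k s).trans
    ((Forest.card_count_siblingPattern_comm a b n k s).trans
      (Forest.card_ncseq_occCount b a n k s).symm)
end

section
/- Let a, m ≥ 2. If n ≥ a + m − 1, then the total number of occurrences of the subword 12⋯(m−1)m^a (a strictly increasing run of m−1 distinct letters followed by a copies of the m-th, largest, letter) over all non-crossing partitions of [n] equals (r/(2r+m))·binom(2r+m, r), where r = n − a − m + 2. -/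
open Finset

/-! ### Ballot-type recursions -/

/-- The number of ways to continue a non-crossing partition with `k` open blocks by `s` letters. -/
def extCount : ℕ → ℕ → ℕ
  | 0, _ => 1
  | s + 1, k => ∑ j ∈ range (k + 1), extCount s (j + 1)

/-- The number of ways to continue a non-crossing partition, after a letter that leaves `k` open
blocks, with a marked run of `c` ascents (starting at that letter or later) and `s` letters
outside the run. -/
def markedCount (c : ℕ) : ℕ → ℕ → ℕ
  | 0, _ => 1
  | s + 1, k => extCount (s + 1) (k + c) + ∑ j ∈ range (k + 1), markedCount c s (j + 1)

lemma extCount_succ_succ (s k : ℕ) :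
    extCount (s + 1) (k + 1) = extCount (s + 1) k + extCount s (k + 2) := by
  simp only [extCount]
  rw [sum_range_succ]

lemma markedCount_succ_succ (c s k : ℕ) :
    markedCount c (s + 1) (k + 1) =
      markedCount c (s + 1) k + extCount s (k + c + 2) + markedCount c s (k + 2) := by
  have h := extCount_succ_succ s (k + c)
  rw [markedCount, markedCount, sum_range_succ, show k + 1 + c = k + c + 1 by ring, h]
  ring

lemma extCount_add_choose (s k : ℕ) :
    extCount s k + (2 * s + k).choose (s + k + 1) = (2 * s + k).choose (s + k) := by
  induction s generalizing k with
  | zero => simp [extCount]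
  | succ s ih =>
    induction k with
    | zero =>
      have h := ih 1
      have e : extCount (s + 1) 0 = extCount s 1 := by simp [extCount]
      have p₁ := Nat.choose_succ_succ' (2 * s + 1) s
      have p₂ := Nat.choose_succ_succ' (2 * s + 1) (s + 1)
      have p₃ : (2 * s + 1).choose s = (2 * s + 1).choose (s + 1) :=
        Nat.choose_symm_of_eq_add (by ring)
      rw [e, show 2 * (s + 1) + 0 = 2 * s + 1 + 1 by ring, show s + 1 + 0 = s + 1 by ring]
      omega
    | succ k ihk =>
      have h := ih (k + 2)
      have e := extCount_succ_succ s k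
      have p₁ := Nat.choose_succ_succ' (2 * s + k + 2) (s + k + 1)
      have p₂ := Nat.choose_succ_succ' (2 * s + k + 2) (s + k + 2)
      rw [show 2 * (s + 1) + (k + 1) = 2 * s + k + 2 + 1 by ring,
        show s + 1 + (k + 1) = s + k + 1 + 1 by ring, p₁, p₂]
      rw [show 2 * (s + 1) + k = 2 * s + k + 2 by ring, show s + 1 + k = s + k + 1 by ring] at ihk
      rw [show 2 * s + (k + 2) = 2 * s + k + 2 by ring, show s + (k + 2) = s + k + 2 by ring] at h
      simp only [add_assoc, Nat.reduceAdd] at *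
      omega

lemma markedCount_eq_choose (c s k : ℕ) :
    markedCount c s k =
      (2 * s + c + k).choose (s + c + k) + k * (2 * s + c + k).choose (s + c + k + 1) := by
  induction s generalizing k with
  | zero => simp [markedCount]
  | succ s ih =>
    induction k with
    | zero =>
      have e : markedCount c (s + 1) 0 = extCount (s + 1) c + markedCount c s 1 := by
        simp [markedCount]
      have h := extCount_add_choose (s + 1) c
      have p := Nat.choose_succ_succ' (2 * s + c + 1) (s + c + 1)
      have q := ih 1
      rw [show 2 * (s + 1) + c = 2 * s + c + 1 + 1 by ring, show s + 1 + c = s + c + 1 by ring] at *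
      simp only [add_zero, zero_mul]
      omega
    | succ k ihk =>
      have e := markedCount_succ_succ c s k
      have h := extCount_add_choose s (k + c + 2)
      have q := ih (k + 2)
      have p₁ := Nat.choose_succ_succ' (2 * s + c + k + 2) (s + c + k + 1)
      have p₂ := Nat.choose_succ_succ' (2 * s + c + k + 2) (s + c + k + 2)
      rw [show 2 * (s + 1) + c + (k + 1) = 2 * s + c + k + 2 + 1 by ring,
        show s + 1 + c + (k + 1) = s + c + k + 1 + 1 by ring]
      rw [show 2 * (s + 1) + c + k = 2 * s + c + k + 2 by ring,
        show s + 1 + c + k = s + c + k + 1 by ring] at ihk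
      rw [show 2 * s + (k + c + 2) = 2 * s + c + k + 2 by ring,
        show s + (k + c + 2) = s + c + k + 2 by ring] at h
      rw [show 2 * s + c + (k + 2) = 2 * s + c + k + 2 by ring,
        show s + c + (k + 2) = s + c + k + 2 by ring] at q
      rw [p₁, p₂, e]
      simp only [add_assoc, Nat.reduceAdd] at *
      nlinarith

/-! ### Non-crossing words generated letter by letter -/

/-- The open letters after reading `x`, if `S` is the set of open letters before. -/
def nextOpen (S : Finset ℕ) (x : ℕ) : Finset ℕ := insert x (S.filter (· < x))

/-- The words of length `n` that extend a non-crossing word with open letters `S` and maximum `M`. -/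
def ncWords : ℕ → Finset ℕ → ℕ → Finset (List ℕ)
  | 0, _, _ => {[]}
  | n + 1, S, M =>
    (insert (M + 1) S).biUnion fun x => (ncWords n (nextOpen S x) (max M x)).image (List.cons x)

lemma sum_ncWords_succ (n : ℕ) (S : Finset ℕ) (M : ℕ) (g : List ℕ → ℕ) :
    ∑ l ∈ ncWords (n + 1) S M, g l =
      ∑ x ∈ insert (M + 1) S, ∑ t ∈ ncWords n (nextOpen S x) (max M x), g (x :: t) := by
  rw [ncWords, sum_biUnion]
  · refine sum_congr rfl fun x _ => ?_
    rw [sum_image]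
    intro a _ b _ h
    simpa using h
  · intro x _ y _ hxy
    simp only [Function.onFun, Finset.disjoint_left, Finset.mem_image]
    rintro _ ⟨t, _, rfl⟩ ⟨u, _, h⟩
    exact hxy (List.cons.inj h).1.symm

lemma cons_mem_ncWords {n : ℕ} {S : Finset ℕ} {M x : ℕ} {t : List ℕ} :
    x :: t ∈ ncWords (n + 1) S M ↔
      x ∈ insert (M + 1) S ∧ t ∈ ncWords n (nextOpen S x) (max M x) := by
  simp only [ncWords, Finset.mem_biUnion, Finset.mem_image]
  constructor
  · rintro ⟨y, hy, u, hu, h⟩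
    obtain ⟨rfl, rfl⟩ := List.cons.inj h
    exact ⟨hy, hu⟩
  · rintro ⟨hx, ht⟩
    exact ⟨x, hx, t, ht, rfl⟩

lemma length_of_mem_ncWords {n : ℕ} {S : Finset ℕ} {M : ℕ} {l : List ℕ}
    (h : l ∈ ncWords n S M) : l.length = n := by
  induction n generalizing S M l with
  | zero => simp_all [ncWords]
  | succ n ih =>
    cases l with
    | nil => simp [ncWords] at h
    | cons x t => simp [ih (cons_mem_ncWords.1 h).2]

lemma sum_card_filter_lt (T : Finset ℕ) (g : ℕ → ℕ) :
    ∑ x ∈ T, g #(T.filter (· < x)) = ∑ j ∈ range #T, g j := by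
  induction T using Finset.induction_on_max with
  | empty => simp
  | insert a T hT ih =>
    have ha : a ∉ T := fun h => (hT a h).false
    rw [sum_insert ha, card_insert_of_notMem ha, sum_range_succ, add_comm, ← ih]
    congr 1
    · refine sum_congr rfl fun x hx => ?_
      rw [filter_insert, if_neg (hT x hx).not_gt]
    · rw [filter_insert, if_neg (lt_irrefl a), filter_true_of_mem hT]

lemma sum_nextOpen {S : Finset ℕ} {M : ℕ} (hS : ∀ y ∈ S, y ≤ M) (g : ℕ → ℕ) :
    ∑ x ∈ insert (M + 1) S, g #(nextOpen S x) = ∑ j ∈ range (#S + 1), g (j + 1) := by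
  have hM : M + 1 ∉ S := fun h => by have := hS _ h; omega
  rw [← card_insert_of_notMem hM, ← sum_card_filter_lt _ fun j => g (j + 1)]
  refine sum_congr rfl fun x hx => ?_
  have hx' : x ≤ M + 1 := by
    rcases Finset.mem_insert.1 hx with rfl | h
    · rfl
    · have := hS x h
      omega
  rw [nextOpen, card_insert_of_notMem (by simp), filter_insert, if_neg hx'.not_gt]

lemma nextOpen_le (S : Finset ℕ) (M x : ℕ) :
    ∀ y ∈ nextOpen S x, y ≤ max M x := by
  intro y hy
  simp only [nextOpen, Finset.mem_insert, Finset.mem_filter] at hy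
  omega

lemma card_ncWords (n : ℕ) {S : Finset ℕ} {M : ℕ} (hS : ∀ y ∈ S, y ≤ M) :
    #(ncWords n S M) = extCount n #S := by
  induction n generalizing S M with
  | zero => simp [ncWords, extCount]
  | succ n ih =>
    rw [card_eq_sum_ones, sum_ncWords_succ, extCount, ← sum_nextOpen hS]
    refine sum_congr rfl fun x _ => ?_
    rw [← card_eq_sum_ones, ih (nextOpen_le S M x)]

/-! ### The pattern read letter by letter -/

/-- After the letter `x`, the word starts with `c` ascents followed by `d` levels. -/
def AscLevels : ℕ → ℕ → ℕ → List ℕ → Prop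
  | _, 0, 0, _ => True
  | _, _ + 1, _, [] => False
  | _, 0, _ + 1, [] => False
  | x, c + 1, d, y :: t => x < y ∧ AscLevels y c d t
  | x, 0, d + 1, y :: t => y = x ∧ AscLevels y 0 d t

open scoped Classical in
lemma sum_ascLevels (c d s : ℕ) {S : Finset ℕ} {M x : ℕ} (hS : ∀ y ∈ S, y ≤ M) (hx : x ∈ S)
    (hmax : ∀ y ∈ S, y ≤ x) :
    ∑ l ∈ ncWords (c + d + s) S M, (if AscLevels x c d l then 1 else 0) =
      extCount s (#S + c) := by
  have hM : M + 1 ∉ S := fun h => by have := hS _ h; omega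
  induction c generalizing S M x with
  | zero =>
    induction d with
    | zero => simp [AscLevels, ← card_ncWords s hS]
    | succ d ih =>
      have hopen : nextOpen S x = S := by
        ext y
        simp only [nextOpen, Finset.mem_insert, Finset.mem_filter]
        constructor
        · rintro (rfl | h)
          exacts [hx, h.1]
        · intro h
          rcases (hmax y h).eq_or_lt with h' | h'
          exacts [Or.inl h', Or.inr ⟨h, h'⟩]
      rw [show 0 + (d + 1) + s = (0 + d + s) + 1 by ring, sum_ncWords_succ,
        sum_eq_single_of_mem x (Finset.mem_insert_of_mem hx), hopen, max_eq_left (hS x hx), ← ih]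
      · simp [AscLevels]
      · intro y _ hy
        simp [AscLevels, hy]
  | succ c ih =>
    have hopen : nextOpen S (M + 1) = insert (M + 1) S := by
      rw [nextOpen, filter_true_of_mem]
      intro y hy
      have := hS y hy
      omega
    have hle : ∀ y ∈ insert (M + 1) S, y ≤ M + 1 := by
      intro y hy
      rcases Finset.mem_insert.1 hy with rfl | h
      · rfl
      · have := hS y h
        omega
    rw [show c + 1 + d + s = (c + d + s) + 1 by ring, sum_ncWords_succ,
      sum_eq_single_of_mem (M + 1) (Finset.mem_insert_self _ _), hopen,
      max_eq_right (Nat.le_succ M), show #S + (c + 1) = #(insert (M + 1) S) + c by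
        rw [card_insert_of_notMem hM]; ring,
      ← ih hle (Finset.mem_insert_self _ _) hle (fun h => by have := hle _ h; omega)]
    · have := hS x hx
      simp [AscLevels, show x < M + 1 by omega]
    · intro y hy hne
      have := hmax y (Finset.mem_of_mem_insert_of_ne hy hne)
      simp [AscLevels, show ¬ x < y by omega]

lemma ascLevels_iff (x c d : ℕ) (t : List ℕ) :
    AscLevels x c d t ↔ c + d ≤ t.length ∧
      (∀ j < c, (x :: t).getD j 0 < (x :: t).getD (j + 1) 0) ∧
      ∀ j, c ≤ j → j < c + d → (x :: t).getD (j + 1) 0 = (x :: t).getD j 0 := by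
  induction t generalizing x c d with
  | nil => cases c <;> cases d <;> simp [AscLevels]
  | cons y t ih =>
    cases c with
    | succ c =>
      rw [AscLevels, ih]
      constructor
      · rintro ⟨h, h₁, h₂, h₃⟩
        refine ⟨by simp; omega, ?_, ?_⟩
        · rintro (_ | j) hj
          · simpa using h
          · simpa using h₂ j (by omega)
        · rintro (_ | j) hj hj'
          · omega
          · simpa using h₃ j (by omega) (by omega)
      · rintro ⟨h₁, h₂, h₃⟩
        refine ⟨by simpa using h₂ 0 (by omega), by simp at h₁; omega, ?_, ?_⟩
        · intro j hj
          simpa using h₂ (j + 1) (by omega)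
        · intro j hj hj'
          simpa using h₃ (j + 1) (by omega) (by omega)
    | zero =>
      cases d with
      | zero => simp [AscLevels]
      | succ d =>
        rw [AscLevels, ih]
        constructor
        · rintro ⟨h, h₁, h₂, h₃⟩
          refine ⟨by simp; omega, by simp, ?_⟩
          rintro (_ | j) hj hj'
          · simpa using h
          · simpa using h₃ j (by omega) (by omega)
        · rintro ⟨h₁, h₂, h₃⟩
          refine ⟨by simpa using h₃ 0 (by omega) (by omega), by simp at h₁; omega, by simp, ?_⟩
          intro j hj hj'
          simpa using h₃ (j + 1) (by omega) (by omega)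

/-- The subword pattern `12⋯(m-1)m^a`. -/
abbrev ascLevelPattern (a m : ℕ) : List ℕ :=
  (List.range (m - 1)).map (· + 1) ++ List.replicate a m

lemma length_ascLevelPattern (a m : ℕ) : (ascLevelPattern a m).length = m - 1 + a := by
  simp [ascLevelPattern]

lemma getD_ascLevelPattern {a m j : ℕ} (hm : 1 ≤ m) (hj : j < m - 1 + a) :
    (ascLevelPattern a m).getD j 0 = min (j + 1) m := by
  rcases lt_or_ge j (m - 1) with h | h
  · rw [List.getD_append _ _ _ _ (by simpa using h)]
    simp [h]
    omega
  · rw [List.getD_append_right _ _ _ _ (by simpa using h)]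
    rw [List.getD_eq_getElem _ _ (by simp; omega)]
    simp
    omega

lemma getD_take_of_lt (l : List ℕ) {n j : ℕ} (h : j < n) : (l.take n).getD j 0 = l.getD j 0 := by
  simp [List.getD_eq_getElem?_getD, h]

lemma occAt_zero_cons_iff {a m : ℕ} (ha : 1 ≤ a) (hm : 1 ≤ m) (x : ℕ) (t : List ℕ) :
    occAt (ascLevelPattern a m) (x :: t) 0 ↔ AscLevels x (m - 1) (a - 1) t := by
  rw [ascLevels_iff, occAt, OrdIso, length_ascLevelPattern]
  set w := x :: t with hw
  have hlen : w.length = t.length + 1 := by simp [hw]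
  constructor
  · rintro ⟨h₁, h₂⟩
    simp only [List.drop_zero, List.length_take] at h₁ h₂
    refine ⟨by omega, ?_, ?_⟩
    · intro j hj
      have := h₂ j (j + 1) (by omega) (by omega)
      rw [getD_ascLevelPattern hm (by omega), getD_ascLevelPattern hm (by omega),
        getD_take_of_lt _ (by omega), getD_take_of_lt _ (by omega)] at this
      omega
    · intro j hj hj'
      have h₃ := h₂ j (j + 1) (by omega) (by omega)
      have h₄ := h₂ (j + 1) j (by omega) (by omega)
      rw [getD_ascLevelPattern hm (by omega), getD_ascLevelPattern hm (by omega),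
        getD_take_of_lt _ (by omega), getD_take_of_lt _ (by omega)] at h₃ h₄
      omega
  · rintro ⟨h₁, h₂, h₃⟩
    have key : ∀ k j, j < k → k < m - 1 + a →
        w.getD j 0 ≤ w.getD k 0 ∧ (w.getD j 0 < w.getD k 0 ↔ j < m - 1) := by
      intro k
      induction k with
      | zero => omega
      | succ k ih =>
        intro j hj hk
        have hstep : (k < m - 1 → w.getD k 0 < w.getD (k + 1) 0) ∧
            (m - 1 ≤ k → w.getD (k + 1) 0 = w.getD k 0) :=
          ⟨fun h => h₂ k h, fun h => h₃ k h (by omega)⟩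
        rcases Nat.lt_succ_iff_lt_or_eq.1 hj with h | rfl
        · have := ih j h (by omega)
          omega
        · omega
    refine ⟨by simp; omega, fun j k hj hk => ?_⟩
    rw [List.drop_zero, getD_ascLevelPattern hm hj, getD_ascLevelPattern hm hk,
      getD_take_of_lt _ hj, getD_take_of_lt _ hk]
    rcases lt_trichotomy j k with h | rfl | h
    · have := key k j h hk
      omega
    · omega
    · have := key j k h hj
      omega

lemma add_length_le_of_occAt {τ l : List ℕ} {i : ℕ} (hτ : 0 < τ.length) (h : occAt τ l i) :
    i + τ.length ≤ l.length := by
  have := h.1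
  simp only [List.length_take, List.length_drop] at this
  omega

/-! ### Counting marked occurrences -/

open scoped Classical in
/-- The number of occurrences of `τ` in `l`, as the cardinality of a filtered range. -/
noncomputable def occNum (τ l : List ℕ) : ℕ := #((range l.length).filter (occAt τ l))

open scoped Classical in
lemma occNum_cons (τ : List ℕ) (x : ℕ) (t : List ℕ) :
    occNum τ (x :: t) = (if occAt τ (x :: t) 0 then 1 else 0) + occNum τ t := by
  simp only [occNum, card_filter, List.length_cons]
  rw [sum_range_succ', add_comm]
  rfl

lemma occNum_eq_zero {τ l : List ℕ} (h : l.length < τ.length) : occNum τ l = 0 := by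
  classical
  rw [occNum, card_eq_zero, filter_eq_empty_iff]
  intro i _ hocc
  have := add_length_le_of_occAt (by omega) hocc
  omega

lemma sum_occNum {a m : ℕ} (ha : 1 ≤ a) (hm : 1 ≤ m) (s : ℕ) {S : Finset ℕ} {M : ℕ}
    (hS : ∀ y ∈ S, y ≤ M) :
    ∑ l ∈ ncWords (m - 1 + (a - 1) + s + 1) S M, occNum (ascLevelPattern a m) l =
      ∑ j ∈ range (#S + 1), markedCount (m - 1) s (j + 1) := by
  classical
  have first : ∀ (s x : ℕ) (S : Finset ℕ) (M : ℕ),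
      ∑ t ∈ ncWords (m - 1 + (a - 1) + s) (nextOpen S x) (max M x),
        (if occAt (ascLevelPattern a m) (x :: t) 0 then 1 else 0) =
      extCount s (#(nextOpen S x) + (m - 1)) := by
    intro s x S M
    simp only [occAt_zero_cons_iff ha hm]
    refine sum_ascLevels _ _ _ (nextOpen_le S M x) (Finset.mem_insert_self _ _) ?_
    intro y hy
    simp only [nextOpen, Finset.mem_insert, Finset.mem_filter] at hy
    omega
  induction s generalizing S M with
  | zero =>
    rw [sum_ncWords_succ, ← sum_nextOpen hS]
    refine sum_congr rfl fun x _ => ?_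
    have first₀ := first 0 x S M
    rw [add_zero] at first₀
    simp only [occNum_cons]
    rw [sum_add_distrib, first₀, sum_eq_zero]
    · simp [extCount, markedCount]
    · intro t ht
      apply occNum_eq_zero
      rw [length_of_mem_ncWords ht, length_ascLevelPattern]
      omega
  | succ s ih =>
    rw [sum_ncWords_succ, ← sum_nextOpen hS]
    refine sum_congr rfl fun x _ => ?_
    simp only [occNum_cons]
    rw [sum_add_distrib, first (s + 1) x S M, ← add_assoc, ih (nextOpen_le S M x), markedCount]

/-! ### Canonical sequential forms are the generated words -/

/-- Appending `y` to `p` would create a crossing. -/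
def Blocked (p : List ℕ) (y : ℕ) : Prop :=
  ∃ i j k : ℕ, i < j ∧ j < k ∧ k < p.length ∧
    p.getD i 0 = p.getD k 0 ∧ p.getD j 0 = y ∧ p.getD i 0 < y

open scoped Classical in
/-- The letters of the restricted growth sequence `p` that may be used again. -/
noncomputable def openLetters (p : List ℕ) : Finset ℕ :=
  (Icc 1 (p.foldr max 0)).filter fun y => ¬ Blocked p y

lemma foldr_max_append_singleton (p : List ℕ) (x : ℕ) :
    (p ++ [x]).foldr max 0 = max (p.foldr max 0) x := by
  induction p with
  | nil => simp
  | cons y p ih => simp only [List.cons_append, List.foldr_cons, ih, max_assoc]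

lemma le_foldr_max {p : List ℕ} {y : ℕ} (h : y ∈ p) : y ≤ p.foldr max 0 := by
  induction p with
  | nil => simp at h
  | cons z p ih =>
    rcases List.mem_cons.1 h with rfl | h
    · simp
    · have := ih h
      simp [this]

lemma getD_append_singleton (p : List ℕ) (x i : ℕ) :
    (p ++ [x]).getD i 0 = if i < p.length then p.getD i 0 else if i = p.length then x else 0 := by
  split_ifs with h h'
  · exact List.getD_append _ _ _ _ h
  · subst h'
    simp
  · exact List.getD_eq_default _ _ (by simp; omega)

lemma isRGS_append_singleton (p : List ℕ) (x : ℕ) :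
    IsRGS (p ++ [x]) ↔ IsRGS p ∧ 1 ≤ x ∧ x ≤ p.foldr max 0 + 1 := by
  rcases eq_or_ne p [] with rfl | hp
  · simp [IsRGS]
    omega
  have hpos : 0 < p.length := List.length_pos_iff.2 hp
  have h0 : (p ++ [x]).getD 0 1 = p.getD 0 1 := List.getD_append _ _ _ _ hpos
  have hget : ∀ i, i + 1 < p.length → (p ++ [x]).getD (i + 1) 0 = p.getD (i + 1) 0 :=
    fun i hi => List.getD_append _ _ _ _ hi
  have htake : ∀ i, i + 1 ≤ p.length → (p ++ [x]).take (i + 1) = p.take (i + 1) :=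
    fun i hi => List.take_append_of_le_length hi
  constructor
  · rintro ⟨h₁, h₂, h₃⟩
    refine ⟨⟨h0 ▸ h₁, fun y hy => h₂ y (by simp [hy]), fun i hi => ?_⟩, h₂ x (by simp), ?_⟩
    · have := h₃ i (by simp; omega)
      rwa [hget i hi, htake i hi.le] at this
    · have := h₃ (p.length - 1) (by simp; omega)
      rw [htake _ (by omega), Nat.sub_add_cancel hpos] at this
      simpa using this
  · rintro ⟨⟨h₁, h₂, h₃⟩, hx, hx'⟩
    refine ⟨h0 ▸ h₁, ?_, fun i hi => ?_⟩
    · intro y hy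
      rcases List.mem_append.1 hy with h | h
      · exact h₂ y h
      · simp at h
        omega
    · simp only [List.length_append, List.length_singleton] at hi
      rw [htake i (by omega)]
      rcases Nat.lt_succ_iff_lt_or_eq.1 hi with h | h
      · rw [hget i h]
        exact h₃ i h
      · rw [h, List.take_length]
        simpa using hx'

lemma crossing_append_singleton (p : List ℕ) (x : ℕ) :
    Crossing (p ++ [x]) ↔ Crossing p ∨ Blocked p x := by
  constructor
  · rintro ⟨i, j, k, l, hij, hjk, hkl, hl, h₁, h₂, h₃⟩
    simp only [List.length_append, List.length_singleton] at hl
    simp only [getD_append_singleton] at h₁ h₂ h₃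
    rw [if_pos (by omega), if_pos (by omega)] at h₁ h₃
    rw [if_pos (by omega)] at h₂
    rcases Nat.lt_succ_iff_lt_or_eq.1 hl with h | h
    · rw [if_pos h] at h₂
      exact Or.inl ⟨i, j, k, l, hij, hjk, hkl, h, h₁, h₂, h₃⟩
    · rw [if_neg (by omega), if_pos h] at h₂
      exact Or.inr ⟨i, j, k, hij, hjk, by omega, h₁, h₂, h₂ ▸ h₃⟩
  · rintro (⟨i, j, k, l, hij, hjk, hkl, hl, h⟩ | ⟨i, j, k, hij, hjk, hk, h₁, h₂, h₃⟩)
    · refine ⟨i, j, k, l, hij, hjk, hkl, by simp; omega, ?_⟩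
      simp only [getD_append_singleton]
      rwa [if_pos (by omega), if_pos (by omega), if_pos (by omega), if_pos (by omega)]
    · refine ⟨i, j, k, p.length, hij, hjk, hk, by simp, ?_⟩
      simp only [getD_append_singleton]
      rw [if_pos (by omega), if_pos (by omega), if_pos (by omega), if_neg (by omega), if_pos trivial]
      exact ⟨h₁, h₂, h₂ ▸ h₃⟩

lemma blocked_append_singleton (p : List ℕ) (x y : ℕ) :
    Blocked (p ++ [x]) y ↔ Blocked p y ∨
      (x < y ∧ ∃ i j : ℕ, i < j ∧ j < p.length ∧ p.getD i 0 = x ∧ p.getD j 0 = y) := by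
  constructor
  · rintro ⟨i, j, k, hij, hjk, hk, h₁, h₂, h₃⟩
    simp only [List.length_append, List.length_singleton] at hk
    simp only [getD_append_singleton] at h₁ h₂ h₃
    rw [if_pos (by omega)] at h₁ h₂ h₃
    rcases Nat.lt_succ_iff_lt_or_eq.1 hk with h | h
    · rw [if_pos h] at h₁
      exact Or.inl ⟨i, j, k, hij, hjk, h, h₁, h₂, h₃⟩
    · rw [if_neg (by omega), if_pos h] at h₁
      exact Or.inr ⟨h₁ ▸ h₃, i, j, hij, by omega, h₁, h₂⟩
  · rintro (⟨i, j, k, hij, hjk, hk, h⟩ | ⟨hxy, i, j, hij, hj, h₁, h₂⟩)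
    · refine ⟨i, j, k, hij, hjk, by simp; omega, ?_⟩
      simp only [getD_append_singleton]
      rwa [if_pos (by omega), if_pos (by omega), if_pos (by omega)]
    · refine ⟨i, j, p.length, hij, hj, by simp, ?_⟩
      simp only [getD_append_singleton]
      rw [if_pos (by omega), if_neg (by omega), if_pos trivial, if_pos (by omega)]
      exact ⟨h₁, h₂, h₁ ▸ hxy⟩

lemma Blocked.mem {p : List ℕ} {y : ℕ} (h : Blocked p y) : y ∈ p := by
  obtain ⟨i, j, k, -, hjk, hk, -, rfl, -⟩ := h
  rw [List.getD_eq_getElem _ _ (hjk.trans hk)]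
  exact List.getElem_mem _

lemma IsRGS.of_append {p t : List ℕ} (h : IsRGS (p ++ t)) : IsRGS p := by
  induction t using List.reverseRecOn with
  | nil => simpa using h
  | append_singleton t x ih =>
    rw [← List.append_assoc, isRGS_append_singleton] at h
    exact ih h.1

lemma IsRGS.mem_of_le {p : List ℕ} (h : IsRGS p) {x : ℕ} (hx : 1 ≤ x)
    (hx' : x ≤ p.foldr max 0) : x ∈ p := by
  induction p using List.reverseRecOn with
  | nil => simp at hx'; omega
  | append_singleton p y ih =>
    rw [isRGS_append_singleton] at h
    rw [foldr_max_append_singleton] at hx'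
    rw [List.mem_append, List.mem_singleton]
    rcases le_or_gt x (p.foldr max 0) with hle | hlt
    · exact Or.inl (ih h.1 hle)
    · right
      omega

lemma IsRGS.exists_lt {p : List ℕ} (h : IsRGS p) {x y : ℕ} (hx : 1 ≤ x) (hxy : x < y)
    (hy : y ∈ p) :
    ∃ i j : ℕ, i < j ∧ j < p.length ∧ p.getD i 0 = x ∧ p.getD j 0 = y := by
  obtain ⟨s, t, rfl⟩ := List.append_of_mem hy
  rw [show s ++ y :: t = (s ++ [y]) ++ t by simp] at h
  have hs := (isRGS_append_singleton s y).1 h.of_append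
  obtain ⟨i, hi, rfl⟩ := List.getElem_of_mem (hs.1.mem_of_le hx (by omega))
  refine ⟨i, s.length, hi, by simp, ?_, by simp⟩
  rw [List.getD_append _ _ _ _ hi, List.getD_eq_getElem _ _ hi]

lemma mem_insert_openLetters {p : List ℕ} {x : ℕ} :
    x ∈ insert (p.foldr max 0 + 1) (openLetters p) ↔
      (1 ≤ x ∧ x ≤ p.foldr max 0 + 1) ∧ ¬ Blocked p x := by
  simp only [openLetters, Finset.mem_insert, Finset.mem_filter, Finset.mem_Icc]
  constructor
  · rintro (rfl | h)
    · refine ⟨⟨by omega, le_rfl⟩, fun hb => ?_⟩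
      have := le_foldr_max hb.mem
      omega
    · exact ⟨⟨h.1.1, by omega⟩, h.2⟩
  · rintro ⟨⟨h₁, h₂⟩, h₃⟩
    rcases Nat.le_succ_iff.1 h₂ with h | h
    · exact Or.inr ⟨⟨h₁, h⟩, h₃⟩
    · exact Or.inl h

lemma openLetters_append_singleton {p : List ℕ} (hp : IsRGS p) {x : ℕ}
    (hx : x ∈ insert (p.foldr max 0 + 1) (openLetters p)) :
    openLetters (p ++ [x]) = nextOpen (openLetters p) x := by
  obtain ⟨⟨hx₁, hx₂⟩, hx₃⟩ := mem_insert_openLetters.1 hx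
  ext y
  simp only [openLetters, nextOpen, Finset.mem_insert, Finset.mem_filter, Finset.mem_Icc,
    foldr_max_append_singleton, blocked_append_singleton]
  rcases lt_trichotomy y x with h | rfl | h
  · have h₁ : y ≤ max (p.foldr max 0) x ↔ y ≤ p.foldr max 0 := by omega
    simp [h, h.ne, h.not_gt, h₁]
  · simp [hx₁, hx₃]
  · simp only [h, h.ne', h.not_gt, and_false, or_false, iff_false, true_and]
    rintro ⟨⟨hy₁, hy₂⟩, hb⟩
    exact hb (Or.inr (hp.exists_lt hx₁ h (hp.mem_of_le hy₁ (by omega))))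

lemma mem_ncWords_iff {p : List ℕ} (hp : IsRGS p) (hc : ¬ Crossing p) (n : ℕ) (t : List ℕ) :
    t ∈ ncWords n (openLetters p) (p.foldr max 0) ↔
      t.length = n ∧ IsRGS (p ++ t) ∧ ¬ Crossing (p ++ t) := by
  induction t generalizing p n with
  | nil =>
    cases n with
    | zero => simp [ncWords, hp, hc]
    | succ n => simp [ncWords]
  | cons x t ih =>
    cases n with
    | zero => simp [ncWords]
    | succ n =>
      rw [cons_mem_ncWords, show p ++ x :: t = (p ++ [x]) ++ t by simp, List.length_cons,
        Nat.add_right_cancel_iff]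
      by_cases hx : x ∈ insert (p.foldr max 0 + 1) (openLetters p)
      · obtain ⟨hx₁, hx₂⟩ := mem_insert_openLetters.1 hx
        rw [← openLetters_append_singleton hp hx, ← foldr_max_append_singleton,
          ih ((isRGS_append_singleton p x).2 ⟨hp, hx₁⟩)
            (by rw [crossing_append_singleton]; tauto)]
        simp only [hx, true_and]
      · simp only [hx, false_and, false_iff]
        rintro ⟨-, h₁, h₂⟩
        refine hx (mem_insert_openLetters.2
          ⟨((isRGS_append_singleton p x).1 h₁.of_append).2, fun hb => h₂ ?_⟩)
        obtain ⟨i, j, k, l, hij, hjk, hkl, hl, h⟩ :=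
          (crossing_append_singleton p x).2 (Or.inr hb)
        refine ⟨i, j, k, l, hij, hjk, hkl, by rw [List.length_append]; omega, ?_⟩
        rwa [List.getD_append _ _ _ i (by omega), List.getD_append _ _ _ j (by omega),
          List.getD_append _ _ _ k (by omega), List.getD_append _ _ _ l (by omega)]

lemma mem_ncWords_empty_iff (n : ℕ) (l : List ℕ) : l ∈ ncWords n ∅ 0 ↔ NCseq n l := by
  have hp : IsRGS [] := by simp [IsRGS]
  have hc : ¬ Crossing [] := by simp [Crossing]
  have ho : openLetters [] = ∅ := by simp [openLetters]
  simpa [ho, NCseq] using mem_ncWords_iff hp hc n l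

lemma totalOcc_eq_sum (n : ℕ) {τ : List ℕ} (hτ : 0 < τ.length) :
    totalOcc n τ = ∑ l ∈ ncWords n ∅ 0, occNum τ l := by
  classical
  simp only [occNum]
  rw [← card_sigma, totalOcc, ← Nat.card_eq_finsetCard]
  refine Nat.card_congr ⟨fun p => ⟨⟨p.1.1, p.1.2⟩, ?_⟩, fun p => ⟨(p.1.1, p.1.2), ?_⟩, ?_, ?_⟩
  · obtain ⟨⟨l, i⟩, h₁, h₂⟩ := p
    have := add_length_le_of_occAt hτ h₂
    simp only [Finset.mem_sigma, mem_ncWords_empty_iff, Finset.mem_filter, Finset.mem_range]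
    exact ⟨h₁, by dsimp only at *; omega, h₂⟩
  · obtain ⟨⟨l, i⟩, h⟩ := p
    simp only [Finset.mem_sigma, mem_ncWords_empty_iff, Finset.mem_filter] at h
    exact ⟨h.1, h.2.2⟩
  · intro p
    rfl
  · intro p
    rfl

/-- For a, m ≥ 2 and n ≥ a + m − 1, the total number of occurrences of the
subword 12⋯(m−1)m^a over NC_n equals (r/(2r+m))·binom(2r+m, r), where
r = n − a − m + 2 (stated multiplicatively to avoid division). -/
theorem stmt16 (a m n : ℕ) (ha : 2 ≤ a) (hm : 2 ≤ m) (hn : a + m - 1 ≤ n) :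
    (2 * (n + 2 - a - m) + m) *
        totalOcc n ((List.range (m - 1)).map (· + 1) ++ List.replicate a m) =
      (n + 2 - a - m) * Nat.choose (2 * (n + 2 - a - m) + m) (n + 2 - a - m) := by
  obtain ⟨s, hs⟩ : ∃ s, n + 2 - a - m = s + 1 := ⟨n + 1 - a - m, by omega⟩
  obtain ⟨c, rfl⟩ : ∃ c, m = c + 1 := ⟨m - 1, by omega⟩
  have htotal : totalOcc n (ascLevelPattern a (c + 1)) = (2 * s + c + 2).choose s := by
    rw [totalOcc_eq_sum _ (by rw [length_ascLevelPattern]; omega),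
      show n = c + 1 - 1 + (a - 1) + s + 1 by omega,
      sum_occNum (by omega) (by omega) s (by simp)]
    simp only [card_empty, zero_add, sum_range_one, markedCount_eq_choose, one_mul,
      Nat.add_sub_cancel]
    rw [← Nat.choose_succ_succ']
    exact Nat.choose_symm_of_eq_add (by ring)
  rw [hs, htotal, show 2 * (s + 1) + (c + 1) = 2 * s + c + 2 + 1 by ring,
    Nat.add_one_mul_choose_eq, mul_comm]
end
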